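/- arXiv:1211.7325 — 2 statements merged into one kernel-verified Lean document; each statement's English description precedes it below -/
import Mathlib

section
/- For all real ν ≥ 1/2, all real β with -1 < β < 1, and all x > 0, ∫_x^∞ e^{βt} t^ν K_ν(t) dt ≤ (2√π Γ(ν+1/2)/((1-β²)^{ν+1/2} Γ(ν))) e^{βx} x^ν K_ν(x). -/
open Real MeasureTheory

/-- The modified Bessel function of the second kind
`K_ν(x) = ∫_0^∞ e^{-x cosh t} cosh(ν t) dt`. -/
noncomputable def besselK (ν x : ℝ) : ℝ :=
  ∫ t in Set.Ioi (0 : ℝ), Real.exp (-x * Real.cosh t) * Real.cosh (ν * t)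

/-- The integral `∫_0^∞ v^{a-1} e^{-v - x²/(4v)} dv`, a Gaussian mixture with Gamma weights. -/
noncomputable def gammaMix (a x : ℝ) : ℝ :=
  ∫ v in Set.Ioi (0 : ℝ), v ^ (a - 1) * Real.exp (-v - x ^ 2 / (4 * v))

lemma continuousOn_gammaMix_integrand (a c : ℝ) :
    ContinuousOn (fun v : ℝ => v ^ (a - 1) * Real.exp (-v - c / (4 * v))) (Set.Ioi 0) := by
  intro v hv
  have hv' : (0 : ℝ) < v := hv
  have h4 : 4 * v ≠ 0 := by positivity
  apply ContinuousAt.continuousWithinAt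
  have h1 : ContinuousAt (fun v : ℝ => v ^ (a - 1)) v :=
    Real.continuousAt_rpow_const v _ (Or.inl hv'.ne')
  fun_prop (disch := assumption)

lemma aestronglyMeasurable_gammaMix_integrand (a c : ℝ) :
    AEStronglyMeasurable (fun v : ℝ => v ^ (a - 1) * Real.exp (-v - c / (4 * v)))
      (volume.restrict (Set.Ioi 0)) :=
  (continuousOn_gammaMix_integrand a c).aestronglyMeasurable measurableSet_Ioi

lemma integrableOn_gammaMix_integrand (a : ℝ) {c : ℝ} (hc : 0 < c) :
    IntegrableOn (fun v : ℝ => v ^ (a - 1) * Real.exp (-v - c / (4 * v))) (Set.Ioi 0) := by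
  obtain ⟨n, hn⟩ := exists_nat_gt (-a)
  have hint : IntegrableOn
      (fun v : ℝ => (n.factorial : ℝ) * (4 / c) ^ n * (Real.exp (-v) * v ^ (a + n - 1)))
      (Set.Ioi 0) :=
    (Real.GammaIntegral_convergent (s := a + n) (by linarith)).const_mul _
  refine Integrable.mono' hint (aestronglyMeasurable_gammaMix_integrand a c) ?_
  refine (ae_restrict_iff' measurableSet_Ioi).2 (Filter.Eventually.of_forall fun v hv => ?_)
  have hv : (0 : ℝ) < v := hv
  rw [Real.norm_of_nonneg (by positivity)]
  have h1 := Real.pow_div_factorial_le_exp (c / (4 * v)) (by positivity) n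
  have h2 : Real.exp (-(c / (4 * v))) ≤ n.factorial * (4 / c) ^ n * v ^ n := by
    rw [Real.exp_neg]
    calc (Real.exp (c / (4 * v)))⁻¹ ≤ ((c / (4 * v)) ^ n / n.factorial)⁻¹ :=
          inv_anti₀ (by positivity) h1
      _ = _ := by
          rw [inv_div, div_eq_mul_inv, ← inv_pow, inv_div, mul_assoc, ← mul_pow]
          congr 2
          ring
  rw [show a + n - 1 = (a - 1) + n by ring, Real.rpow_add hv, Real.rpow_natCast,
    sub_eq_add_neg (-v), Real.exp_add]
  calc v ^ (a - 1) * (Real.exp (-v) * Real.exp (-(c / (4 * v))))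
      ≤ v ^ (a - 1) * (Real.exp (-v) * (n.factorial * (4 / c) ^ n * v ^ n)) := by gcongr
    _ = _ := by ring

lemma gammaMix_zero {a : ℝ} (ha : 0 < a) : gammaMix a 0 = Real.Gamma a := by
  rw [Real.Gamma_eq_integral ha]
  simp [gammaMix, mul_comm]

lemma continuous_gammaMix {a : ℝ} (ha : 0 < a) : Continuous (gammaMix a) := by
  refine continuous_of_dominated (bound := fun v : ℝ => Real.exp (-v) * v ^ (a - 1))
    (fun x => aestronglyMeasurable_gammaMix_integrand a (x ^ 2)) (fun x => ?_)
    (Real.GammaIntegral_convergent ha) (Filter.Eventually.of_forall fun v => by fun_prop)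
  refine (ae_restrict_iff' measurableSet_Ioi).2 (Filter.Eventually.of_forall fun v hv => ?_)
  have hv : (0 : ℝ) < v := hv
  rw [Real.norm_of_nonneg (by positivity), mul_comm]
  have : 0 ≤ x ^ 2 / (4 * v) := by positivity
  gcongr
  linarith

lemma hasDerivAt_gammaMix (a : ℝ) {x : ℝ} (hx : 0 < x) :
    HasDerivAt (gammaMix a) (-(x / 2) * gammaMix (a - 1) x) x := by
  have key := (hasDerivAt_integral_of_dominated_loc_of_deriv_le
    (μ := volume.restrict (Set.Ioi (0 : ℝ))) (x₀ := x) (s := Set.Ioo (x / 2) (2 * x))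
    (F := fun x v => v ^ (a - 1) * Real.exp (-v - x ^ 2 / (4 * v)))
    (F' := fun x v => -(x / 2) * (v ^ (a - 1 - 1) * Real.exp (-v - x ^ 2 / (4 * v))))
    (bound := fun v => x * (v ^ (a - 1 - 1) * Real.exp (-v - (x / 2) ^ 2 / (4 * v))))
    (Ioo_mem_nhds (by linarith) (by linarith))
    (Filter.Eventually.of_forall fun y => aestronglyMeasurable_gammaMix_integrand a (y ^ 2))
    (integrableOn_gammaMix_integrand a (by positivity))
    ((aestronglyMeasurable_gammaMix_integrand (a - 1) (x ^ 2)).const_mul _) ?_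
    ((integrableOn_gammaMix_integrand (a - 1) (by positivity)).const_mul _) ?_).2
  · rw [integral_const_mul] at key
    exact key
  · refine (ae_restrict_iff' measurableSet_Ioi).2 (Filter.Eventually.of_forall fun v hv y hy => ?_)
    have hv : (0 : ℝ) < v := hv
    have hy0 : 0 < y := by linarith [hy.1]
    rw [norm_mul, norm_neg, Real.norm_of_nonneg (by positivity), Real.norm_of_nonneg (by positivity)]
    have h1 := hy.1
    have h2 := hy.2
    gcongr
    linarith
  · refine (ae_restrict_iff' measurableSet_Ioi).2 (Filter.Eventually.of_forall fun v hv y _ => ?_)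
    have hv : (0 : ℝ) < v := hv
    have h : HasDerivAt (fun y : ℝ => -v - y ^ 2 / (4 * v)) (-(2 * y / (4 * v))) y := by
      simpa using (((hasDerivAt_id y).pow 2).div_const (4 * v)).const_sub (-v)
    refine (h.exp.const_mul (v ^ (a - 1))).congr_deriv ?_
    rw [Real.rpow_sub_one hv.ne' (a - 1)]
    field_simp
    ring

lemma gammaMix_pos (a : ℝ) {x : ℝ} (hx : 0 < x) : 0 < gammaMix a x := by
  refine (setIntegral_pos_iff_support_of_nonneg_ae ?_
    (integrableOn_gammaMix_integrand a (by positivity))).2 ?_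
  · refine (ae_restrict_iff' measurableSet_Ioi).2 (Filter.Eventually.of_forall fun v hv => ?_)
    have hv : (0 : ℝ) < v := hv
    simp only [Pi.zero_apply]
    positivity
  · rw [Set.inter_eq_right.2]
    · simp
    · intro v hv
      have hv : (0 : ℝ) < v := hv
      exact ne_of_gt (by positivity)

lemma exp_subst_gammaMix_integrand (a : ℝ) {x : ℝ} (hx : 0 < x) (u : ℝ) :
    |x / 2 * Real.exp u| • ((x / 2 * Real.exp u) ^ (a - 1) *
      Real.exp (-(x / 2 * Real.exp u) - x ^ 2 / (4 * (x / 2 * Real.exp u)))) =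
    (x / 2) ^ a * Real.exp (a * u - x * Real.cosh u) := by
  have h0 : 0 < x / 2 * Real.exp u := by positivity
  have h1 : -(x / 2 * Real.exp u) - x ^ 2 / (4 * (x / 2 * Real.exp u)) = -(x * Real.cosh u) := by
    rw [Real.cosh_eq, Real.exp_neg]
    field_simp
    ring
  rw [abs_of_pos h0, smul_eq_mul, h1, Real.rpow_sub_one h0.ne',
    Real.mul_rpow (by positivity) (by positivity), ← Real.exp_mul, sub_eq_add_neg (a * u),
    Real.exp_add, mul_comm a u]
  field_simp

lemma image_mul_exp_univ {x : ℝ} (hx : 0 < x) :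
    (fun u : ℝ => x / 2 * Real.exp u) '' Set.univ = Set.Ioi 0 := by
  ext v
  simp only [Set.image_univ, Set.mem_range, Set.mem_Ioi]
  constructor
  · rintro ⟨u, rfl⟩
    positivity
  · intro hv
    refine ⟨Real.log (v / (x / 2)), ?_⟩
    rw [Real.exp_log (by positivity)]
    field_simp

lemma hasDerivWithinAt_mul_exp (x u : ℝ) :
    HasDerivWithinAt (fun u : ℝ => x / 2 * Real.exp u) (x / 2 * Real.exp u) Set.univ u :=
  ((Real.hasDerivAt_exp u).const_mul _).hasDerivWithinAt

lemma injOn_mul_exp {x : ℝ} (hx : 0 < x) :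
    Set.InjOn (fun u : ℝ => x / 2 * Real.exp u) Set.univ := fun u _ w _ h =>
  Real.exp_injective (mul_left_cancel₀ (by positivity : x / 2 ≠ 0) h)

lemma integrable_exp_sub_cosh (a : ℝ) {x : ℝ} (hx : 0 < x) :
    Integrable (fun u : ℝ => Real.exp (a * u - x * Real.cosh u)) := by
  have h := (integrableOn_image_iff_integrableOn_abs_deriv_smul MeasurableSet.univ
    (fun u _ => hasDerivWithinAt_mul_exp x u) (injOn_mul_exp hx)
    (fun v : ℝ => v ^ (a - 1) * Real.exp (-v - x ^ 2 / (4 * v)))).1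
    (by rw [image_mul_exp_univ hx]; exact integrableOn_gammaMix_integrand a (by positivity))
  simp only [exp_subst_gammaMix_integrand a hx, integrableOn_univ] at h
  have h' := h.const_mul ((x / 2) ^ a)⁻¹
  have hne : (x / 2) ^ a ≠ 0 := by positivity
  simpa [inv_mul_cancel_left₀ hne] using h'

lemma gammaMix_eq_integral_exp (a : ℝ) {x : ℝ} (hx : 0 < x) :
    gammaMix a x = (x / 2) ^ a * ∫ u : ℝ, Real.exp (a * u - x * Real.cosh u) := by
  have h := integral_image_eq_integral_abs_deriv_smul MeasurableSet.univ
    (fun u _ => hasDerivWithinAt_mul_exp x u) (injOn_mul_exp hx)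
    (fun v : ℝ => v ^ (a - 1) * Real.exp (-v - x ^ 2 / (4 * v)))
  simp only [exp_subst_gammaMix_integrand a hx, image_mul_exp_univ hx, Measure.restrict_univ,
    integral_const_mul] at h
  exact h

lemma exp_mul_cosh_eq (a x u : ℝ) :
    Real.exp (-x * Real.cosh u) * Real.cosh (a * u) =
      (Real.exp (a * u - x * Real.cosh u) + Real.exp (-a * u - x * Real.cosh u)) / 2 := by
  rw [Real.cosh_eq (a * u), sub_eq_add_neg, sub_eq_add_neg, Real.exp_add, Real.exp_add,
    neg_mul, neg_mul]
  ring

lemma integrable_exp_mul_cosh (a : ℝ) {x : ℝ} (hx : 0 < x) :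
    Integrable (fun u : ℝ => Real.exp (-x * Real.cosh u) * Real.cosh (a * u)) := by
  simp only [exp_mul_cosh_eq]
  exact ((integrable_exp_sub_cosh a hx).add (integrable_exp_sub_cosh (-a) hx)).div_const 2

lemma gammaMix_eq_besselK (a : ℝ) {x : ℝ} (hx : 0 < x) :
    gammaMix a x = 2 * (x / 2) ^ a * besselK a x := by
  have h1 := integral_comp_abs
    (f := fun u : ℝ => Real.exp (-x * Real.cosh u) * Real.cosh (a * u))
  have h2 : ∀ u : ℝ, Real.exp (-x * Real.cosh |u|) * Real.cosh (a * |u|) =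
      Real.exp (-x * Real.cosh u) * Real.cosh (a * u) := fun u => by
    rcases abs_choice u with h | h <;> simp [h]
  have h3 : ∫ u : ℝ, Real.exp (-a * u - x * Real.cosh u) =
      ∫ u : ℝ, Real.exp (a * u - x * Real.cosh u) := by
    rw [← integral_neg_eq_self]
    simp
  simp only [h2] at h1
  simp only [exp_mul_cosh_eq] at h1
  rw [integral_div, integral_add (integrable_exp_sub_cosh a hx) (integrable_exp_sub_cosh (-a) hx),
    h3, add_self_div_two] at h1
  rw [gammaMix_eq_integral_exp a hx, h1, besselK]
  simp only [exp_mul_cosh_eq]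
  ring

lemma cosh_mul_cosh_le {ν t s : ℝ} (hν : 1 / 2 ≤ ν) (ht : 0 ≤ t) (hts : t ≤ s) :
    Real.cosh ((ν - 1) * s) * Real.cosh (ν * t) ≤ Real.cosh ((ν - 1) * t) * Real.cosh (ν * s) := by
  have prod (p q : ℝ) :
      Real.cosh p * Real.cosh q = (Real.cosh (q + p) + Real.cosh (q - p)) / 2 := by
    rw [Real.cosh_add, Real.cosh_sub]
    ring
  have h1 : Real.cosh (ν * t + (ν - 1) * s) ≤ Real.cosh (ν * s + (ν - 1) * t) := by
    rw [Real.cosh_le_cosh]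
    apply abs_le_abs <;> nlinarith
  have h2 : Real.cosh (ν * t - (ν - 1) * s) ≤ Real.cosh (ν * s - (ν - 1) * t) := by
    rw [Real.cosh_le_cosh]
    apply abs_le_abs <;> nlinarith
  rw [prod, prod]
  linarith

/-- The ratio `K_{ν-1} / K_ν` is nondecreasing for `ν ≥ 1/2`. -/
lemma besselK_mul_besselK_le {ν x y : ℝ} (hν : 1 / 2 ≤ ν) (hx : 0 < x) (hxy : x ≤ y) :
    besselK (ν - 1) x * besselK ν y ≤ besselK (ν - 1) y * besselK ν x := by
  have hy : 0 < y := hx.trans_le hxy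
  set μ := volume.restrict (Set.Ioi (0 : ℝ)) with hμ
  set k : ℝ → ℝ → ℝ → ℝ := fun a x u => Real.exp (-x * Real.cosh u) * Real.cosh (a * u) with hk
  have hi (a x : ℝ) (hx : 0 < x) : Integrable (k a x) μ := (integrable_exp_mul_cosh a hx).restrict
  have hp (a b x y : ℝ) (hx : 0 < x) (hy : 0 < y) :
      Integrable (fun z : ℝ × ℝ => k a x z.1 * k b y z.2) (μ.prod μ) :=
    (hi a x hx).mul_prod (hi b y hy)
  have hv (a b x y : ℝ) :
      ∫ z : ℝ × ℝ, k a x z.1 * k b y z.2 ∂μ.prod μ = besselK a x * besselK b y :=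
    integral_prod_mul (k a x) (k b y)
  have hnonneg : 0 ≤ ∫ z : ℝ × ℝ, ((k (ν - 1) y z.1 * k ν x z.2 + k ν x z.1 * k (ν - 1) y z.2) -
      (k (ν - 1) x z.1 * k ν y z.2 + k ν y z.1 * k (ν - 1) x z.2)) ∂μ.prod μ := by
    apply integral_nonneg_of_ae
    rw [hμ, Measure.prod_restrict]
    refine (ae_restrict_iff' (measurableSet_Ioi.prod measurableSet_Ioi)).2
      (Filter.Eventually.of_forall ?_)
    rintro ⟨t, s⟩ ⟨ht, hs⟩
    have ht : 0 < t := ht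
    have hs : 0 < s := hs
    have hexp {t s : ℝ} (ht : 0 < t) (hts : t ≤ s) :
        Real.exp (-x * Real.cosh t) * Real.exp (-y * Real.cosh s) ≤
          Real.exp (-y * Real.cosh t) * Real.exp (-x * Real.cosh s) := by
      rw [← Real.exp_add, ← Real.exp_add, Real.exp_le_exp]
      have : Real.cosh t ≤ Real.cosh s := by
        rw [Real.cosh_le_cosh]
        exact abs_le_abs_of_nonneg ht.le hts
      nlinarith
    simp only [hk, Pi.zero_apply]
    rcases le_total t s with h | h
    · linarith [mul_nonneg (sub_nonneg.2 (cosh_mul_cosh_le hν ht.le h))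
        (sub_nonneg.2 (hexp ht h))]
    · linarith [mul_nonneg (sub_nonneg.2 (cosh_mul_cosh_le hν hs.le h))
        (sub_nonneg.2 (hexp hs h))]
  have hadd (a b x y : ℝ) (hx : 0 < x) (hy : 0 < y) :
      Integrable (fun z : ℝ × ℝ => k a x z.1 * k b y z.2 + k b y z.1 * k a x z.2) (μ.prod μ) :=
    (hp a b x y hx hy).add (hp b a y x hy hx)
  rw [integral_sub (hadd _ _ _ _ hy hx) (hadd _ _ _ _ hx hy),
    integral_add (hp _ _ _ _ hy hx) (hp _ _ _ _ hx hy),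
    integral_add (hp _ _ _ _ hx hy) (hp _ _ _ _ hy hx)] at hnonneg
  simp only [hv] at hnonneg
  linarith

lemma mul_gammaMix_sub_one {a x : ℝ} (hx : 0 < x) :
    x / 2 * gammaMix (a - 1) x = 2 * (x / 2) ^ a * besselK (a - 1) x := by
  rw [gammaMix_eq_besselK _ hx, Real.rpow_sub_one (by positivity)]
  field_simp

lemma gammaMix_add_mul_le {ν x s : ℝ} (hν : 1 / 2 ≤ ν) (hx : 0 ≤ x) (hs : 0 < s) :
    gammaMix ν (x + s) * Real.Gamma ν ≤ gammaMix ν x * gammaMix ν s := by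
  have hν0 : 0 < ν := by linarith
  have hpos : ∀ y, 0 ≤ y → 0 < gammaMix ν y := fun y hy => by
    rcases hy.eq_or_lt with rfl | h
    · rw [gammaMix_zero hν0]
      exact Real.Gamma_pos_of_pos hν0
    · exact gammaMix_pos ν h
  have hd : ∀ y, 0 < y → HasDerivAt (fun y => gammaMix ν (y + s) / gammaMix ν y)
      ((-((y + s) / 2) * gammaMix (ν - 1) (y + s) * gammaMix ν y -
        gammaMix ν (y + s) * (-(y / 2) * gammaMix (ν - 1) y)) / gammaMix ν y ^ 2) y := fun y hy =>
    ((hasDerivAt_gammaMix ν (by linarith : 0 < y + s)).comp_add_const y s).div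
      (hasDerivAt_gammaMix ν hy) (hpos y hy.le).ne'
  have hanti : AntitoneOn (fun y => gammaMix ν (y + s) / gammaMix ν y) (Set.Ici 0) := by
    apply antitoneOn_of_deriv_nonpos (convex_Ici 0)
    · have hc := continuous_gammaMix hν0
      refine ContinuousOn.div (by fun_prop) hc.continuousOn fun y hy => (hpos y hy).ne'
    · rw [interior_Ici]
      exact fun y hy => (hd y hy).differentiableAt.differentiableWithinAt
    · rw [interior_Ici]
      intro y hy
      have hy : 0 < y := hy
      rw [(hd y hy).deriv]
      apply div_nonpos_of_nonpos_of_nonneg _ (sq_nonneg _)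
      have hys : 0 < y + s := by linarith
      simp only [neg_mul]
      rw [mul_gammaMix_sub_one hys, mul_gammaMix_sub_one hy,
        gammaMix_eq_besselK _ hys, gammaMix_eq_besselK _ hy]
      have h := mul_le_mul_of_nonneg_left (besselK_mul_besselK_le hν hy (by linarith : y ≤ y + s))
        (by positivity : 0 ≤ 4 * ((y + s) / 2) ^ ν * (y / 2) ^ ν)
      linarith
  have h := hanti (Set.mem_Ici.2 le_rfl) (Set.mem_Ici.2 hx) hx
  simp only [zero_add, gammaMix_zero hν0] at h
  rw [div_le_div_iff₀ (hpos x hx) (Real.Gamma_pos_of_pos hν0)] at h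
  linarith

lemma exp_mul_gaussian_eq (β : ℝ) {v : ℝ} (hv : 0 < v) (s : ℝ) :
    Real.exp (β * s) * Real.exp (-v - s ^ 2 / (4 * v)) =
      Real.exp (-((1 - β ^ 2) * v)) * Real.exp (-(1 / (4 * v)) * (s - 2 * β * v) ^ 2) := by
  rw [← Real.exp_add, ← Real.exp_add]
  congr 1
  field_simp
  ring

lemma integrable_exp_mul_gaussian (β : ℝ) {v : ℝ} (hv : 0 < v) :
    Integrable (fun s : ℝ => Real.exp (β * s) * Real.exp (-v - s ^ 2 / (4 * v))) := by
  simp only [exp_mul_gaussian_eq β hv]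
  exact ((integrable_exp_neg_mul_sq (by positivity : 0 < 1 / (4 * v))).comp_sub_right _).const_mul _

lemma integral_exp_mul_gaussian (β : ℝ) {v : ℝ} (hv : 0 < v) :
    ∫ s : ℝ, Real.exp (β * s) * Real.exp (-v - s ^ 2 / (4 * v)) =
      2 * √π * v ^ (1 / 2 : ℝ) * Real.exp (-((1 - β ^ 2) * v)) := by
  simp only [exp_mul_gaussian_eq β hv]
  rw [integral_const_mul,
    integral_sub_right_eq_self (fun s : ℝ => Real.exp (-(1 / (4 * v)) * s ^ 2)) (2 * β * v),
    integral_gaussian, ← Real.sqrt_eq_rpow,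
    show π / (1 / (4 * v)) = 2 ^ 2 * (π * v) by field_simp; norm_num,
    Real.sqrt_mul (by positivity), Real.sqrt_sq (by norm_num), Real.sqrt_mul Real.pi_pos.le]
  ring

lemma integral_mixture (a β : ℝ) {v : ℝ} (hv : 0 < v) :
    ∫ s : ℝ, Real.exp (β * s) * (v ^ (a - 1) * Real.exp (-v - s ^ 2 / (4 * v))) =
      2 * √π * (v ^ (a + 1 / 2 - 1) * Real.exp (-((1 - β ^ 2) * v))) := by
  simp only [mul_left_comm _ (v ^ (a - 1))]
  rw [integral_const_mul, integral_exp_mul_gaussian β hv,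
    show a + 1 / 2 - 1 = (a - 1) + 1 / 2 by ring, Real.rpow_add hv]
  ring

lemma integrable_mixture {a β : ℝ} (ha : 0 < a) (hβ : 0 < 1 - β ^ 2) :
    Integrable (fun z : ℝ × ℝ =>
        Real.exp (β * z.1) * (z.2 ^ (a - 1) * Real.exp (-z.2 - z.1 ^ 2 / (4 * z.2))))
      (volume.prod (volume.restrict (Set.Ioi (0 : ℝ)))) := by
  have hm : Measurable (fun z : ℝ × ℝ =>
      Real.exp (β * z.1) * (z.2 ^ (a - 1) * Real.exp (-z.2 - z.1 ^ 2 / (4 * z.2)))) := by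
    fun_prop
  refine (integrable_prod_iff' hm.aestronglyMeasurable).2 ⟨?_, ?_⟩
  · refine (ae_restrict_iff' measurableSet_Ioi).2 (Filter.Eventually.of_forall fun v hv => ?_)
    simp only [mul_left_comm _ (v ^ (a - 1))]
    exact (integrable_exp_mul_gaussian β hv).const_mul _
  · have h : IntegrableOn (fun v : ℝ =>
        2 * √π * (v ^ (a + 1 / 2 - 1) * Real.exp (-((1 - β ^ 2) * v)))) (Set.Ioi 0) := by
      have := integrableOn_rpow_mul_exp_neg_mul_rpow (p := 1) (s := a + 1 / 2 - 1)
        (by linarith) one_pos hβ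
      simp only [Real.rpow_one, neg_mul] at this
      exact this.const_mul _
    refine IntegrableOn.congr_fun h (fun v hv => ?_) measurableSet_Ioi
    have hv : (0 : ℝ) < v := hv
    simp only
    rw [← integral_mixture a β hv]
    congr 1
    ext s
    rw [Real.norm_of_nonneg (by positivity)]

lemma integrable_exp_mul_gammaMix {a β : ℝ} (ha : 0 < a) (hβ : 0 < 1 - β ^ 2) :
    Integrable (fun s : ℝ => Real.exp (β * s) * gammaMix a s) := by
  have h := (integrable_mixture ha hβ).integral_prod_left
  simp only [integral_const_mul] at h
  exact h

lemma integral_exp_mul_gammaMix {a β : ℝ} (ha : 0 < a) (hβ : 0 < 1 - β ^ 2) :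
    ∫ s : ℝ, Real.exp (β * s) * gammaMix a s =
      2 * √π * Real.Gamma (a + 1 / 2) / (1 - β ^ 2) ^ (a + 1 / 2) := by
  have h := integral_integral_swap (f := fun s v : ℝ =>
    Real.exp (β * s) * (v ^ (a - 1) * Real.exp (-v - s ^ 2 / (4 * v)))) (integrable_mixture ha hβ)
  simp only [integral_const_mul] at h
  refine h.trans ?_
  rw [setIntegral_congr_fun measurableSet_Ioi fun v hv => integral_mixture a β hv,
    integral_const_mul, Real.integral_rpow_mul_exp_neg_mul_Ioi (by linarith) hβ,
    Real.div_rpow zero_le_one hβ.le, Real.one_rpow]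
  ring

lemma rpow_mul_besselK (a : ℝ) {x : ℝ} (hx : 0 < x) :
    x ^ a * besselK a x = 2 ^ a / 2 * gammaMix a x := by
  rw [gammaMix_eq_besselK a hx, Real.div_rpow hx.le (by norm_num)]
  field_simp

theorem integral_exp_besselK_le (ν β : ℝ) (hν : 1 / 2 ≤ ν) (hβ1 : -1 < β) (hβ2 : β < 1)
    (x : ℝ) (hx : 0 < x) :
    (∫ t in Set.Ioi x, Real.exp (β * t) * t ^ ν * besselK ν t) ≤
      (2 * Real.sqrt π * Real.Gamma (ν + 1 / 2) /
          ((1 - β ^ 2) ^ (ν + 1 / 2) * Real.Gamma ν)) *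
        Real.exp (β * x) * x ^ ν * besselK ν x := by
  have hν0 : 0 < ν := by linarith
  have hβ : 0 < 1 - β ^ 2 := by nlinarith
  have hΓ : 0 < Real.Gamma ν := Real.Gamma_pos_of_pos hν0
  have hshift : ∫ t in Set.Ioi x, Real.exp (β * t) * t ^ ν * besselK ν t =
      ∫ s in Set.Ioi 0, 2 ^ ν / 2 * (Real.exp (β * (s + x)) * gammaMix ν (s + x)) := by
    have h := (measurePreserving_add_right volume x).setIntegral_preimage_emb
      (measurableEmbedding_addRight x)
      (fun t => 2 ^ ν / 2 * (Real.exp (β * t) * gammaMix ν t)) (Set.Ioi x)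
    rw [Set.preimage_add_const_Ioi, sub_self] at h
    rw [h]
    refine setIntegral_congr_fun measurableSet_Ioi fun t ht => ?_
    rw [mul_assoc, rpow_mul_besselK ν (hx.trans ht)]
    ring
  set C := 2 ^ ν / 2 * (Real.exp (β * x) * gammaMix ν x) / Real.Gamma ν with hC
  have hC0 : 0 ≤ C := by
    have := gammaMix_pos ν hx
    positivity
  calc ∫ t in Set.Ioi x, Real.exp (β * t) * t ^ ν * besselK ν t
      = ∫ s in Set.Ioi 0, 2 ^ ν / 2 * (Real.exp (β * (s + x)) * gammaMix ν (s + x)) := hshift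
    _ ≤ ∫ s in Set.Ioi 0, C * (Real.exp (β * s) * gammaMix ν s) := by
        refine integral_mono_of_nonneg ?_
          ((integrable_exp_mul_gammaMix hν0 hβ).restrict.const_mul C) ?_
        · refine (ae_restrict_iff' measurableSet_Ioi).2
            (Filter.Eventually.of_forall fun s hs => ?_)
          have := gammaMix_pos ν (add_pos hs hx)
          simp only [Pi.zero_apply]
          positivity
        · refine (ae_restrict_iff' measurableSet_Ioi).2
            (Filter.Eventually.of_forall fun s hs => ?_)
          have h : gammaMix ν (s + x) ≤ gammaMix ν x * gammaMix ν s / Real.Gamma ν := by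
            rw [le_div_iff₀ hΓ, add_comm]
            exact gammaMix_add_mul_le hν hx.le hs
          calc 2 ^ ν / 2 * (Real.exp (β * (s + x)) * gammaMix ν (s + x))
              ≤ 2 ^ ν / 2 *
                (Real.exp (β * (s + x)) * (gammaMix ν x * gammaMix ν s / Real.Gamma ν)) := by
                gcongr
            _ = C * (Real.exp (β * s) * gammaMix ν s) := by
                rw [hC, mul_add, Real.exp_add]
                ring
    _ = C * ∫ s in Set.Ioi 0, Real.exp (β * s) * gammaMix ν s := integral_const_mul _ _
    _ ≤ C * ∫ s : ℝ, Real.exp (β * s) * gammaMix ν s := by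
        refine mul_le_mul_of_nonneg_left (setIntegral_le_integral
          (integrable_exp_mul_gammaMix hν0 hβ) (Filter.Eventually.of_forall fun s => ?_)) hC0
        refine mul_nonneg (Real.exp_pos _).le
          (setIntegral_nonneg measurableSet_Ioi fun v hv => ?_)
        have hv : (0 : ℝ) < v := hv
        positivity
    _ = _ := by
        rw [integral_exp_mul_gammaMix hν0 hβ, mul_assoc _ (x ^ ν), rpow_mul_besselK ν hx, hC]
        have : (1 - β ^ 2) ^ (ν + 1 / 2) ≠ 0 := by positivity
        field_simp
end

section
/- For all x > 0, 1/√(x+1/2) < √(2/π) e^x K_0(x) < 1/√x. -/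
open Real MeasureTheory

/-- The modified Bessel function of the second kind of order zero,
`K_0(x) = ∫_1^∞ e^{-xt}/√(t²-1) dt`. -/
noncomputable def besselK0 (x : ℝ) : ℝ :=
  ∫ t in Set.Ioi (1 : ℝ), Real.exp (-x * t) / Real.sqrt (t ^ 2 - 1)

theorem setIntegral_lt_setIntegral_of_forall_lt {X : Type*} [MeasurableSpace X] {μ : Measure X}
    {s : Set X} {f g : X → ℝ} (hs : MeasurableSet s) (hμ : 0 < μ s) (hf : IntegrableOn f s μ)
    (hg : IntegrableOn g s μ) (hlt : ∀ x ∈ s, f x < g x) :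
    ∫ x in s, f x ∂μ < ∫ x in s, g x ∂μ := by
  rw [← sub_pos, ← integral_sub hg hf,
    setIntegral_pos_iff_support_of_nonneg_ae (f := fun x => g x - f x) _ (hg.sub hf)]
  · refine hμ.trans_le (measure_mono fun x hx => ⟨?_, hx⟩)
    exact (sub_pos.2 (hlt x hx)).ne'
  · filter_upwards [ae_restrict_mem hs] with x hx
    exact (sub_pos.2 (hlt x hx)).le

theorem integrableOn_exp_neg_mul_div_sqrt {c : ℝ} (hc : 0 < c) :
    IntegrableOn (fun u : ℝ => exp (-c * u) / √u) (Set.Ioi 0) := by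
  refine (integrableOn_rpow_mul_exp_neg_mul_rpow (s := -(1 / 2)) (p := 1) (by norm_num)
    one_pos hc).congr_fun (fun u hu => ?_) measurableSet_Ioi
  simp only [rpow_one]
  rw [rpow_neg (le_of_lt hu), ← sqrt_eq_rpow]
  ring

theorem integral_exp_neg_mul_div_sqrt {c : ℝ} (hc : 0 < c) :
    ∫ u in Set.Ioi (0 : ℝ), exp (-c * u) / √u = √π / √c := by
  have h := Real.integral_rpow_mul_exp_neg_mul_Ioi (a := 1 / 2) (by norm_num) hc
  rw [Real.Gamma_one_half_eq, ← sqrt_eq_rpow, sqrt_div zero_le_one, sqrt_one] at h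
  rw [← one_div_mul_eq_div, ← h]
  refine setIntegral_congr_fun measurableSet_Ioi fun u hu => ?_
  rw [show (1 / 2 - 1 : ℝ) = -(1 / 2) by norm_num, rpow_neg (le_of_lt hu), ← sqrt_eq_rpow,
    neg_mul]
  ring

theorem exp_mul_besselK0 (x : ℝ) :
    exp x * besselK0 x = ∫ u in Set.Ioi (0 : ℝ), exp (-x * u) / (√u * √(u + 2)) := by
  have h := (measurePreserving_add_right volume (1 : ℝ)).setIntegral_preimage_emb
    (measurableEmbedding_addRight 1)
    (fun t : ℝ => exp (-x * t) / √(t ^ 2 - 1)) (Set.Ioi 1)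
  rw [besselK0, ← h, ← integral_const_mul, Set.preimage_add_const_Ioi, sub_self]
  refine setIntegral_congr_fun measurableSet_Ioi fun u hu => ?_
  rw [← sqrt_mul (le_of_lt hu), mul_div_assoc', ← exp_add]
  ring_nf

theorem exp_neg_mul_div_sqrt_mul_sqrt_lt (x : ℝ) {u : ℝ} (hu : 0 < u) :
    exp (-x * u) / (√u * √(u + 2)) < (1 / √2) * (exp (-x * u) / √u) := by
  have : √2 < √(u + 2) := sqrt_lt_sqrt (by norm_num) (by linarith)
  rw [div_mul_div_comm, one_mul, mul_comm √u]
  gcongr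

theorem lt_exp_neg_mul_div_sqrt_mul_sqrt (x : ℝ) {u : ℝ} (hu : 0 < u) :
    (1 / √2) * (exp (-(x + 1 / 2) * u) / √u) < exp (-x * u) / (√u * √(u + 2)) := by
  have key : √(u + 2) < √2 * exp (u / 2) := by
    rw [sqrt_lt' (by positivity), mul_pow, sq_sqrt zero_le_two, ← exp_nat_mul]
    have := add_one_lt_exp hu.ne'
    rw [show ((2 : ℕ) : ℝ) * (u / 2) = u by push_cast; ring]
    linarith
  have he : exp (-x * u) = exp (-(x + 1 / 2) * u) * exp (u / 2) := by
    rw [← exp_add]; ring_nf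
  rw [he, div_mul_div_comm, one_mul, div_lt_div_iff₀ (by positivity) (by positivity)]
  calc exp (-(x + 1 / 2) * u) * (√u * √(u + 2))
      < exp (-(x + 1 / 2) * u) * (√u * (√2 * exp (u / 2))) := by gcongr
    _ = _ := by ring

theorem integrableOn_exp_neg_mul_div_sqrt_mul_sqrt {x : ℝ} (hx : 0 < x) :
    IntegrableOn (fun u : ℝ => exp (-x * u) / (√u * √(u + 2))) (Set.Ioi 0) := by
  refine ((integrableOn_exp_neg_mul_div_sqrt hx).const_mul (1 / √2)).mono'
    (Measurable.aestronglyMeasurable (by fun_prop)) ?_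
  filter_upwards [ae_restrict_mem measurableSet_Ioi] with u hu
  rw [norm_of_nonneg (by positivity)]
  exact (exp_neg_mul_div_sqrt_mul_sqrt_lt x hu).le

theorem besselK0_bounds (x : ℝ) (hx : 0 < x) :
    1 / Real.sqrt (x + 1 / 2) < Real.sqrt (2 / π) * Real.exp x * besselK0 x ∧
      Real.sqrt (2 / π) * Real.exp x * besselK0 x < 1 / Real.sqrt x := by
  have hx' : 0 < x + 1 / 2 := by positivity
  have hvol : 0 < volume (Set.Ioi (0 : ℝ)) := by simp
  have hint := integrableOn_exp_neg_mul_div_sqrt_mul_sqrt hx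
  have lower := setIntegral_lt_setIntegral_of_forall_lt measurableSet_Ioi hvol
    ((integrableOn_exp_neg_mul_div_sqrt hx').const_mul (1 / √2)) hint
    fun u hu => lt_exp_neg_mul_div_sqrt_mul_sqrt x hu
  have upper := setIntegral_lt_setIntegral_of_forall_lt measurableSet_Ioi hvol hint
    ((integrableOn_exp_neg_mul_div_sqrt hx).const_mul (1 / √2))
    fun u hu => exp_neg_mul_div_sqrt_mul_sqrt_lt x hu
  rw [integral_const_mul, integral_exp_neg_mul_div_sqrt hx', ← exp_mul_besselK0] at lower
  rw [integral_const_mul, integral_exp_neg_mul_div_sqrt hx, ← exp_mul_besselK0] at upper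
  have hpos : 0 < √(2 / π) := by positivity
  have scale (y : ℝ) : 1 / √y = √(2 / π) * (1 / √2 * (√π / √y)) := by
    have : √π ≠ 0 := by positivity
    rw [sqrt_div zero_le_two]
    field_simp
  rw [mul_assoc, scale, scale x]
  exact ⟨mul_lt_mul_of_pos_left lower hpos, mul_lt_mul_of_pos_left upper hpos⟩
end
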